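/- Let A ∈ ℝ^{d1×d2} with A ≠ 0 and nonzero rows, let x* satisfy A x* = b, and let e ∈ ℝ^{d1} be a fixed noise vector. Then for every x ∈ ℝ^{d2}: Σ_{j=1}^{d1} (‖A_j‖₂² / ‖A‖_F²) · ‖x − ((⟨A_j, x⟩ − (b_j + e_j)) / ‖A_j‖₂²) A_jᵀ − x*‖₂² ≤ (1 − σ_min(A)² / ‖A‖_F²) · ‖x − x*‖₂² + ‖e‖₂² / ‖A‖_F². In particular, for e = 0 the one-step randomized Kaczmarz update contracts the expected squared error by the factor 1 − σ_min(A)²/‖A‖_F². -/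

import Mathlib

/-- The smallest singular value of `M`: the largest `σ ≥ 0` with `‖My‖₂ ≥ σ‖y‖₂` for all `y`. -/
noncomputable def sigmaMin {d1 d2 : ℕ} (M : Matrix (Fin d1) (Fin d2) ℝ) : ℝ :=
  sSup {σ : ℝ | 0 ≤ σ ∧ ∀ y : Fin d2 → ℝ,
    σ * Real.sqrt (∑ i, y i ^ 2) ≤ Real.sqrt (∑ i, (∑ j, M i j * y j) ^ 2)}

theorem sigmaMin_nonneg {d1 d2 : ℕ} (M : Matrix (Fin d1) (Fin d2) ℝ) : 0 ≤ sigmaMin M :=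
  Real.sSup_nonneg fun _ h => h.1

theorem sigmaMin_sq_mul_le {d1 d2 : ℕ} (M : Matrix (Fin d1) (Fin d2) ℝ) (y : Fin d2 → ℝ) :
    sigmaMin M ^ 2 * ∑ i, y i ^ 2 ≤ ∑ i, (∑ j, M i j * y j) ^ 2 := by
  have hy : 0 ≤ ∑ i, y i ^ 2 := by positivity
  have hMy : 0 ≤ ∑ i, (∑ j, M i j * y j) ^ 2 := by positivity
  rcases hy.eq_or_lt with h | h
  · rw [← h, mul_zero]
    exact hMy
  · have hs := Real.sqrt_pos.2 h
    have hle : sigmaMin M ≤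
        Real.sqrt (∑ i, (∑ j, M i j * y j) ^ 2) / Real.sqrt (∑ i, y i ^ 2) :=
      Real.sSup_le (fun σ hσ => (le_div_iff₀ hs).2 (hσ.2 y)) (by positivity)
    have hsq := pow_le_pow_left₀ (sigmaMin_nonneg M) hle 2
    rwa [div_pow, Real.sq_sqrt hMy, Real.sq_sqrt hy, le_div_iff₀ h] at hsq

/-- The squared error after projecting `z` along `a` with the residual perturbed by `ε`. -/
theorem sum_sq_kaczmarz_step {ι : Type*} [Fintype ι] (a z : ι → ℝ) (ε : ℝ)
    (ha : ∑ i, a i ^ 2 ≠ 0) :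
    (∑ i, a i ^ 2) * ∑ i, (z i - (∑ k, a k * z k - ε) / (∑ k, a k ^ 2) * a i) ^ 2
      = (∑ i, a i ^ 2) * ∑ i, z i ^ 2 + (ε ^ 2 - (∑ i, a i * z i) ^ 2) := by
  have expand (c : ℝ) : ∑ i, (z i - c * a i) ^ 2
      = ∑ i, z i ^ 2 - 2 * c * ∑ i, a i * z i + c ^ 2 * ∑ i, a i ^ 2 := by
    simp only [Finset.mul_sum, ← Finset.sum_sub_distrib, ← Finset.sum_add_distrib]
    exact Finset.sum_congr rfl fun i _ => by ring
  rw [expand]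
  field_simp
  ring

theorem kaczmarz_expected_sq_error_le {d1 d2 : ℕ}
    (A : Matrix (Fin d1) (Fin d2) ℝ) (hA : A ≠ 0)
    (hrows : ∀ j, ∑ i, A j i ^ 2 ≠ 0)
    (b : Fin d1 → ℝ) (xstar : Fin d2 → ℝ)
    (hsol : ∀ j, ∑ i, A j i * xstar i = b j)
    (e : Fin d1 → ℝ)
    (x : Fin d2 → ℝ) :
    ∑ j, ((∑ i, A j i ^ 2) / (∑ j', ∑ i, A j' i ^ 2)) *
        ∑ i, ((x i - ((∑ i', A j i' * x i') - (b j + e j)) / (∑ i', A j i' ^ 2)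
            * A j i) - xstar i) ^ 2
      ≤ (1 - sigmaMin A ^ 2 / (∑ j', ∑ i, A j' i ^ 2)) * ∑ i, (x i - xstar i) ^ 2
        + (∑ j, e j ^ 2) / (∑ j', ∑ i, A j' i ^ 2) := by
  have hF : 0 < ∑ j, ∑ i, A j i ^ 2 := by
    obtain ⟨j, -⟩ := Function.ne_iff.1 hA
    exact Finset.sum_pos (fun j _ => lt_of_le_of_ne (by positivity) (hrows j).symm)
      ⟨j, Finset.mem_univ j⟩
  have step (j : Fin d1) : (∑ i, A j i ^ 2) *
        ∑ i, ((x i - ((∑ i', A j i' * x i') - (b j + e j)) / (∑ i', A j i' ^ 2)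
            * A j i) - xstar i) ^ 2
      = (∑ i, A j i ^ 2) * ∑ i, (x i - xstar i) ^ 2
        + (e j ^ 2 - (∑ i, A j i * (x i - xstar i)) ^ 2) := by
    rw [← sum_sq_kaczmarz_step (A j) (fun i => x i - xstar i) (e j) (hrows j)]
    have hres : ∑ i, A j i * (x i - xstar i) = ∑ i, A j i * x i - b j := by
      simp only [mul_sub, Finset.sum_sub_distrib, hsol]
    rw [hres]
    congr 1
    exact Finset.sum_congr rfl fun i _ => by ring
  have hσ := sigmaMin_sq_mul_le A fun i => x i - xstar i
  simp only [div_mul_eq_mul_div _ (∑ j, ∑ i, A j i ^ 2), step, ← Finset.sum_div,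
    Finset.sum_add_distrib, Finset.sum_sub_distrib, ← Finset.sum_mul]
  rw [div_le_iff₀ hF]
  field_simp
  linarith


/-- One-step expected contraction for noisy randomized Kaczmarz:
with row `j` sampled with probability `‖A_j‖₂²/‖A‖_F²`,
`∑_j (‖A_j‖₂²/‖A‖_F²)·‖x − ((⟨A_j,x⟩ − (b_j + e_j))/‖A_j‖₂²)A_jᵀ − x*‖₂²
  ≤ (1 − σ_min(A)²/‖A‖_F²)·‖x − x*‖₂² + ‖e‖₂²/‖A‖_F²`;
in particular, for `e = 0` the expected squared error contracts by the factor
`1 − σ_min(A)²/‖A‖_F²`. -/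
theorem stmt_14 (d1 d2 : ℕ)
    (A : Matrix (Fin d1) (Fin d2) ℝ) (hA : A ≠ 0)
    (hrows : ∀ j, ∑ i, A j i ^ 2 ≠ 0)
    (b : Fin d1 → ℝ) (xstar : Fin d2 → ℝ)
    (hsol : ∀ j, ∑ i, A j i * xstar i = b j)
    (e : Fin d1 → ℝ)
    (x : Fin d2 → ℝ) :
    (∑ j, ((∑ i, A j i ^ 2) / (∑ j', ∑ i, A j' i ^ 2)) *
        ∑ i, ((x i - ((∑ i', A j i' * x i') - (b j + e j)) / (∑ i', A j i' ^ 2)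
            * A j i) - xstar i) ^ 2
      ≤ (1 - sigmaMin A ^ 2 / (∑ j', ∑ i, A j' i ^ 2)) * ∑ i, (x i - xstar i) ^ 2
        + (∑ j, e j ^ 2) / (∑ j', ∑ i, A j' i ^ 2))
    ∧ (∑ j, ((∑ i, A j i ^ 2) / (∑ j', ∑ i, A j' i ^ 2)) *
        ∑ i, ((x i - ((∑ i', A j i' * x i') - b j) / (∑ i', A j i' ^ 2)
            * A j i) - xstar i) ^ 2
      ≤ (1 - sigmaMin A ^ 2 / (∑ j', ∑ i, A j' i ^ 2)) * ∑ i, (x i - xstar i) ^ 2) := by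
  refine ⟨kaczmarz_expected_sq_error_le A hA hrows b xstar hsol e x, ?_⟩
  simpa using kaczmarz_expected_sq_error_le A hA hrows b xstar hsol 0 x
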